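/- arXiv:math/0409306 — 2 statements merged into one kernel-verified Lean document; each statement's English description precedes it below -/
import Mathlib

section
/- Let A be a complex unital Banach algebra, let a ≤ b ≤ c be real numbers, and let α : [a,c] → A be continuous. Then the time-ordered exponential satisfies the multiplicative (cocycle) identity Te^{∫_a^c α(s)ds} = Te^{∫_a^b α(s)ds} · Te^{∫_b^c α(s)ds}. -/
open MeasureTheory
noncomputable section

/-- The ordered simplex `{a ≤ s 0 ≤ s 1 ≤ ⋯ ≤ s (n-1) ≤ b}`. -/
def orderedSimplex (n : ℕ) (a b : ℝ) : Set (Fin n → ℝ) :=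
  {s | (∀ i, s i ∈ Set.Icc a b) ∧ Monotone s}

/-- The time-ordered exponential (expansional)
`Te^{∫_a^b α(s)ds} = 1 + Σ_{n≥1} ∫_{a≤s_1≤⋯≤s_n≤b} α(s_1)⋯α(s_n) ds`. -/
def Texp {A : Type*} [NormedRing A] [NormedAlgebra ℂ A] [CompleteSpace A]
    (α : ℝ → A) (a b : ℝ) : A :=
  ∑' n : ℕ, ∫ s in orderedSimplex n a b, (List.ofFn fun i => α (s i)).prod

/-- The `n`-th term of the Picard series solving `du/dt = u α`, `u a = 1`. -/
def picardTerm {A : Type*} [NormedRing A] [NormedAlgebra ℂ A] (α : ℝ → A) (a : ℝ) :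
    ℕ → ℝ → A
  | 0, _ => 1
  | n + 1, b => ∫ t in a..b, picardTerm α a n t * α t

lemma eqOn_orderedSimplex_prod_ofFn {A : Type*} [Monoid A] {n : ℕ} {α β : ℝ → A} {a b : ℝ}
    (h : Set.EqOn α β (Set.Icc a b)) :
    Set.EqOn (fun s : Fin n → ℝ => (List.ofFn fun i => α (s i)).prod)
      (fun s => (List.ofFn fun i => β (s i)).prod) (orderedSimplex n a b) := by
  intro s hs
  have : (fun i => α (s i)) = fun i => β (s i) := funext fun i => h (hs.1 i)
  simp only [this]

lemma isClosed_orderedSimplex (n : ℕ) (a b : ℝ) : IsClosed (orderedSimplex n a b) := by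
  have : orderedSimplex n a b =
      (⋂ i, {s | s i ∈ Set.Icc a b}) ∩ ⋂ i, ⋂ j, ⋂ _ : i ≤ j, {s | s i ≤ s j} := by
    ext s
    simp [orderedSimplex, Monotone]
  rw [this]
  refine (isClosed_iInter fun i => isClosed_Icc.preimage (continuous_apply i)).inter ?_
  exact isClosed_iInter fun i => isClosed_iInter fun j => isClosed_iInter fun _ =>
    isClosed_le (continuous_apply i) (continuous_apply j)

lemma isCompact_orderedSimplex (n : ℕ) (a b : ℝ) : IsCompact (orderedSimplex n a b) :=
  (isCompact_univ_pi fun _ : Fin n => isCompact_Icc (a := a) (b := b)).of_isClosed_subset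
    (isClosed_orderedSimplex n a b) fun _ hs i _ => hs.1 i

lemma snoc_mem_orderedSimplex {n : ℕ} {a b t : ℝ} {s : Fin n → ℝ} :
    (Fin.snoc s t : Fin (n + 1) → ℝ) ∈ orderedSimplex (n + 1) a b ↔
      t ∈ Set.Icc a b ∧ s ∈ orderedSimplex n a t := by
  constructor
  · rintro ⟨h, hm⟩
    refine ⟨by simpa using h (Fin.last n), fun i => ⟨?_, ?_⟩, fun i j hij => ?_⟩
    · simpa using (h i.castSucc).1
    · simpa using hm (Fin.le_last i.castSucc)
    · simpa using hm (Fin.castSucc_le_castSucc_iff.2 hij)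
  · rintro ⟨ht, h, hm⟩
    refine ⟨fun i => ?_, fun i j hij => ?_⟩
    · induction i using Fin.lastCases with
      | last => simpa using ht
      | cast i => simpa using ⟨(h i).1, (h i).2.trans ht.2⟩
    · induction j using Fin.lastCases with
      | last =>
        induction i using Fin.lastCases with
        | last => exact le_rfl
        | cast i => simpa using (h i).2
      | cast j =>
        induction i using Fin.lastCases with
        | last => exact absurd hij (not_le.2 (Fin.castSucc_lt_last j))
        | cast i => simpa using hm (Fin.castSucc_le_castSucc_iff.1 hij)

lemma continuous_prod_ofFn {A : Type*} [NormedRing A] {α : ℝ → A} (hα : Continuous α) (n : ℕ) :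
    Continuous fun s : Fin n → ℝ => (List.ofFn fun i => α (s i)).prod := by
  induction n with
  | zero => simpa using continuous_const
  | succ n ih =>
    simp only [List.ofFn_succ, List.prod_cons]
    exact (hα.comp (continuous_apply 0)).mul
      (ih.comp (continuous_pi fun i : Fin n => continuous_apply i.succ))

section

variable {A : Type*} [NormedRing A] [NormedAlgebra ℂ A]

lemma continuous_picardTerm [CompleteSpace A] {α : ℝ → A} (hα : Continuous α) (a : ℝ) (n : ℕ) :
    Continuous (picardTerm α a n) := by
  induction n with
  | zero => exact continuous_const
  | succ n ih =>
    exact intervalIntegral.continuous_primitive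
      (fun _ _ => (ih.mul hα).intervalIntegrable _ _) a

lemma integral_mul_const_of_complete [CompleteSpace A] {X : Type*} [MeasurableSpace X]
    {μ : Measure X} {f : X → A} (hf : Integrable f μ) (x : A) :
    ∫ t, f t * x ∂μ = (∫ t, f t ∂μ) * x :=
  ((ContinuousLinearMap.mul ℝ A).flip x).integral_comp_comm hf

lemma setIntegral_orderedSimplex [CompleteSpace A] {α : ℝ → A} (hα : Continuous α) (a : ℝ)
    (n : ℕ) {b : ℝ} (hab : a ≤ b) :
    ∫ s in orderedSimplex n a b, (List.ofFn fun i => α (s i)).prod = picardTerm α a n b := by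
  induction n generalizing b with
  | zero =>
    have : orderedSimplex 0 a b = Set.univ :=
      Set.eq_univ_of_forall fun s => ⟨fun i => i.elim0, fun i => i.elim0⟩
    simp [this, picardTerm, Measure.real, volume_pi]
  | succ n ih =>
    let e := MeasurableEquiv.piFinSuccAbove (fun _ : Fin (n + 1) => ℝ) (Fin.last n)
    have he : MeasurePreserving e.symm :=
      (volume_preserving_piFinSuccAbove (fun _ : Fin (n + 1) => ℝ) (Fin.last n)).symm
    have hsymm (p : ℝ × (Fin n → ℝ)) : e.symm p = (Fin.snoc p.2 p.1 : Fin (n + 1) → ℝ) := by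
      simp [e, MeasurableEquiv.piFinSuccAbove, Fin.insertNthEquiv, Fin.insertNth_last']
    let F : (Fin (n + 1) → ℝ) → A := (orderedSimplex (n + 1) a b).indicator
      fun s => (List.ofFn fun i => α (s i)).prod
    have hmeas (m : ℕ) (b : ℝ) := (isClosed_orderedSimplex m a b).measurableSet
    have hint (m : ℕ) (b : ℝ) : IntegrableOn
        (fun s : Fin m → ℝ => (List.ofFn fun i => α (s i)).prod) (orderedSimplex m a b) :=
      (continuous_prod_ofFn hα m).continuousOn.integrableOn_compact
        (isCompact_orderedSimplex m a b)
    have hF : Integrable F := (hint (n + 1) b).integrable_indicator (hmeas _ _)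
    have hFe : Integrable (fun p => F (e.symm p)) :=
      (he.integrable_comp_emb e.symm.measurableEmbedding).2 hF
    calc ∫ s in orderedSimplex (n + 1) a b, (List.ofFn fun i => α (s i)).prod
        = ∫ s, F s := (integral_indicator (hmeas _ _)).symm
      _ = ∫ p, F (e.symm p) := (he.integral_comp e.symm.measurableEmbedding F).symm
      _ = ∫ t, ∫ s, F (e.symm (t, s)) := integral_prod _ hFe
      _ = ∫ t, (Set.Icc a b).indicator (fun t => picardTerm α a n t * α t) t := by
        congr 1
        ext t
        by_cases ht : t ∈ Set.Icc a b
        · rw [Set.indicator_of_mem ht, ← ih ht.1,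
            ← integral_mul_const_of_complete (hint n t), ← integral_indicator (hmeas _ _)]
          congr 1
          ext s
          rw [hsymm]
          by_cases hs : s ∈ orderedSimplex n a t
          · have := snoc_mem_orderedSimplex.2 ⟨ht, hs⟩
            simp only [F, Set.indicator_of_mem this, Set.indicator_of_mem hs]
            rw [List.ofFn_succ', List.prod_concat]
            simp
          · have := fun h => hs (snoc_mem_orderedSimplex.1 h : t ∈ Set.Icc a b ∧ _).2
            simp only [F, Set.indicator_of_notMem this, Set.indicator_of_notMem hs]
        · rw [Set.indicator_of_notMem ht]
          have (s : Fin n → ℝ) : F (e.symm (t, s)) = 0 := by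
            rw [hsymm]
            exact Set.indicator_of_notMem (fun h => ht (snoc_mem_orderedSimplex.1 h).1) _
          simp [this]
      _ = picardTerm α a (n + 1) b := by
        rw [integral_indicator measurableSet_Icc, integral_Icc_eq_integral_Ioc, picardTerm,
          intervalIntegral.integral_of_le hab]

lemma picardTerm_eq_sum_antidiagonal [CompleteSpace A] {α : ℝ → A} (hα : Continuous α)
    (a b c : ℝ) (n : ℕ) :
    picardTerm α a n c =
      ∑ p ∈ Finset.HasAntidiagonal.antidiagonal n, picardTerm α a p.1 b * picardTerm α b p.2 c := by
  induction n generalizing c with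
  | zero => simp [picardTerm]
  | succ n ih =>
    have hint (x : ℝ) (n : ℕ) (u v : ℝ) :
        IntervalIntegrable (fun t => picardTerm α x n t * α t) volume u v :=
      ((continuous_picardTerm hα x n).mul hα).intervalIntegrable u v
    have hmul (x : A) (k : ℕ) : ∫ t in b..c, x * (picardTerm α b k t * α t) =
        x * picardTerm α b (k + 1) c :=
      ((ContinuousLinearMap.mul ℝ A) x).intervalIntegral_comp_comm (hint b k b c)
    have hsucc (x : ℝ) : picardTerm α a (n + 1) x = ∫ t in a..x, picardTerm α a n t * α t := rfl
    rw [Finset.Nat.sum_antidiagonal_succ', hsucc c,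
      ← intervalIntegral.integral_add_adjacent_intervals (hint a n a b) (hint a n b c)]
    congr 1
    · simp [picardTerm]
    · simp_rw [ih, Finset.sum_mul, mul_assoc]
      rw [intervalIntegral.integral_finsetSum
        fun p _ => (continuous_const.mul
          ((continuous_picardTerm hα b p.2).mul hα)).intervalIntegrable _ _]
      simp [hmul]

lemma norm_picardTerm_le [NormOneClass A] {α : ℝ → A} {M : ℝ}
    (hM : ∀ t, ‖α t‖ ≤ M) (a : ℝ) (n : ℕ) {b : ℝ} (hab : a ≤ b) :
    ‖picardTerm α a n b‖ ≤ (M * (b - a)) ^ n / n.factorial := by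
  have hM0 : 0 ≤ M := (norm_nonneg _).trans (hM 0)
  induction n generalizing b with
  | zero => simp [picardTerm]
  | succ n ih =>
    have hcont : Continuous fun t : ℝ => (M * (t - a)) ^ n / n.factorial * M := by fun_prop
    calc ‖picardTerm α a (n + 1) b‖
        ≤ ∫ t in a..b, (M * (t - a)) ^ n / n.factorial * M := by
          refine intervalIntegral.norm_integral_le_of_norm_le hab (.of_forall fun t ht => ?_)
            (hcont.intervalIntegrable a b)
          have : 0 ≤ t - a := by linarith [ht.1]
          refine (norm_mul_le _ _).trans ?_
          exact mul_le_mul (ih ht.1.le) (hM t) (norm_nonneg _) (by positivity)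
      _ = (M * (b - a)) ^ (n + 1) / (n + 1).factorial := by
          have hderiv (t : ℝ) : HasDerivAt
              (fun t : ℝ => (M * (t - a)) ^ (n + 1) / (n + 1).factorial)
              ((M * (t - a)) ^ n / n.factorial * M) t := by
            have h := ((((hasDerivAt_id t).sub_const a).const_mul M).pow (n + 1)).div_const
              ((n + 1).factorial : ℝ)
            refine h.congr_deriv ?_
            rw [Nat.factorial_succ]
            push_cast
            simp only [id, mul_one]
            field_simp
          rw [intervalIntegral.integral_eq_sub_of_hasDerivAt (fun t _ => hderiv t)
            (hcont.intervalIntegrable a b)]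
          simp

lemma summable_norm_picardTerm [NormOneClass A] {α : ℝ → A} {M : ℝ}
    (hM : ∀ t, ‖α t‖ ≤ M) {a b : ℝ} (hab : a ≤ b) :
    Summable fun n => ‖picardTerm α a n b‖ :=
  (Real.summable_pow_div_factorial (M * (b - a))).of_nonneg_of_le (fun _ => norm_nonneg _)
    fun n => norm_picardTerm_le hM a n hab

lemma Texp_eq_tsum_picardTerm [CompleteSpace A] {α β : ℝ → A} (hβ : Continuous β) {a b : ℝ}
    (hab : a ≤ b) (h : Set.EqOn α β (Set.Icc a b)) :
    Texp α a b = ∑' n, picardTerm β a n b :=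
  tsum_congr fun n =>
    (setIntegral_congr_fun (isClosed_orderedSimplex n a b).measurableSet
      (eqOn_orderedSimplex_prod_ofFn h)).trans (setIntegral_orderedSimplex hβ a n hab)

end

/-- The multiplicative (cocycle) identity of the time-ordered exponential:
`Te^{∫_a^c α} = Te^{∫_a^b α} · Te^{∫_b^c α}`. -/
theorem stmt2 {A : Type*} [NormedRing A] [NormOneClass A] [NormedAlgebra ℂ A]
    [CompleteSpace A] (a b c : ℝ) (hab : a ≤ b) (hbc : b ≤ c) (α : ℝ → A)
    (hα : ContinuousOn α (Set.Icc a c)) :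
    Texp α a c = Texp α a b * Texp α b c := by
  have hac := hab.trans hbc
  let β : ℝ → A := Set.IccExtend hac ((Set.Icc a c).domRestrict α)
  have hβ : Continuous β := hα.domRestrict.Icc_extend'
  have h : Set.EqOn α β (Set.Icc a c) := fun t ht =>
    (Set.IccExtend_of_mem hac ((Set.Icc a c).domRestrict α) ht).symm
  obtain ⟨M, hM⟩ := isCompact_Icc.exists_bound_of_continuousOn hα
  have hβM (t : ℝ) : ‖β t‖ ≤ M := hM _ (Set.projIcc a c hac t).2
  rw [Texp_eq_tsum_picardTerm hβ hac h,
    Texp_eq_tsum_picardTerm hβ hab (h.mono (Set.Icc_subset_Icc_right hbc)),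
    Texp_eq_tsum_picardTerm hβ hbc (h.mono (Set.Icc_subset_Icc_left hab)),
    tsum_mul_tsum_eq_tsum_sum_antidiagonal_of_summable_norm
      (summable_norm_picardTerm hβM hab) (summable_norm_picardTerm hβM hbc)]
  exact tsum_congr fun n => picardTerm_eq_sum_antidiagonal hβ a b c n
end
end

section
/- Let A_1, A_2 be N×N strictly upper triangular matrices with entries in K = ℂ({z}), and suppose each equation df/dz = f·A_j (j = 1,2) admits a unipotent solution with entries in K (this is the condition of trivial monodromy). Then the following are equivalent: (i) the connections A_1 dz and A_2 dz are equivalent, i.e. there exists a unipotent matrix h with entries in O such that A_2 = h^{−1}·(dh/dz) + h^{−1} A_1 h; (ii) there exist unipotent solutions f_j of df_j/dz = f_j·A_j (j = 1,2) with entries in K whose Birkhoff decompositions f_j = (f_j^−)^{−1} f_j^+ have equal negative parts, f_1^− = f_2^−. -/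
open MeasureTheory Filter Topology
noncomputable section

/-- A germ belonging to the subring `O ⊂ K` of germs holomorphic at `0`. -/
def MemO (f : ℂ → ℂ) : Prop :=
  ∃ g : ℂ → ℂ, AnalyticAt ℂ g 0 ∧ f =ᶠ[𝓝[≠] (0 : ℂ)] g

/-- A germ belonging to `Q = z⁻¹ ℂ[z⁻¹]`: polynomials in `z⁻¹` without
constant term. -/
def MemQ (f : ℂ → ℂ) : Prop :=
  ∃ p : Polynomial ℂ, p.coeff 0 = 0 ∧
    ∀ᶠ z in 𝓝[≠] (0 : ℂ), f z = Polynomial.eval z⁻¹ p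

/-- A matrix of germs at `0` which is unipotent (upper triangular with all
diagonal entries `1`) with entries in `K = ℂ({z})`. -/
def UnipK {N : ℕ} (F : ℂ → Matrix (Fin N) (Fin N) ℂ) : Prop :=
  (∀ i j, MeromorphicAt (fun z => F z i j) 0) ∧
  (∀ i j : Fin N, j < i → ∀ᶠ z in 𝓝[≠] (0 : ℂ), F z i j = 0) ∧
  (∀ i : Fin N, ∀ᶠ z in 𝓝[≠] (0 : ℂ), F z i i = 1)

/-- A matrix of germs at `0` which is strictly upper triangular with entries in
`K = ℂ({z})`. -/
def StrictUpperK {N : ℕ} (F : ℂ → Matrix (Fin N) (Fin N) ℂ) : Prop :=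
  (∀ i j, MeromorphicAt (fun z => F z i j) 0) ∧
  (∀ i j : Fin N, ¬ i < j → ∀ᶠ z in 𝓝[≠] (0 : ℂ), F z i j = 0)

/-- `f⁺` part of a Birkhoff decomposition: unipotent with entries in `O`. -/
def BirkhoffPos {N : ℕ} (F : ℂ → Matrix (Fin N) (Fin N) ℂ) : Prop :=
  UnipK F ∧ ∀ i j, MemO (fun z => F z i j)

/-- `f⁻` part of a Birkhoff decomposition: unipotent with all off-diagonal
entries in `Q = z⁻¹ℂ[z⁻¹]`. -/
def BirkhoffNeg {N : ℕ} (F : ℂ → Matrix (Fin N) (Fin N) ℂ) : Prop :=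
  UnipK F ∧ ∀ i j : Fin N, i ≠ j → MemQ (fun z => F z i j)

/-- `f` is a solution of the differential system `df/dz = f·A` near `0`,
understood entrywise on a punctured neighborhood of `0`. -/
def IsSol {N : ℕ} (f A : ℂ → Matrix (Fin N) (Fin N) ℂ) : Prop :=
  ∀ᶠ z in 𝓝[≠] (0 : ℂ), ∀ i j,
    HasDerivAt (fun w => f w i j) ((f z * A z) i j) z

/-- The derivative `dh/dz` of a matrix of functions, taken entrywise. -/
def matDeriv {N : ℕ} (h : ℂ → Matrix (Fin N) (Fin N) ℂ) (z : ℂ) :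
    Matrix (Fin N) (Fin N) ℂ :=
  Matrix.of fun i j => deriv (fun w => h w i j) z

/-- Pointwise unipotency: upper triangular with unit diagonal. -/
def IsUnip {N : ℕ} (M : Matrix (Fin N) (Fin N) ℂ) : Prop :=
  M.BlockTriangular id ∧ ∀ i, M i i = 1

namespace IsUnip

variable {N : ℕ} {M M' : Matrix (Fin N) (Fin N) ℂ}

theorem det_eq_one (h : IsUnip M) : M.det = 1 := by
  rw [Matrix.det_of_isUpperTriangular h.1]
  simp [h.2]

theorem isUnit_det (h : IsUnip M) : IsUnit M.det := by
  simp [h.det_eq_one]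

theorem inv_eq_adjugate (h : IsUnip M) : M⁻¹ = M.adjugate := by
  simp [Matrix.inv_def, h.det_eq_one]

theorem mul (h : IsUnip M) (h' : IsUnip M') : IsUnip (M * M') := by
  refine ⟨h.1.mul h'.1, fun i => ?_⟩
  rw [Matrix.mul_apply, Finset.sum_eq_single i]
  · simp [h.2, h'.2]
  · intro k _ hk
    rcases lt_or_gt_of_ne hk with hlt | hlt
    · rw [h.1 hlt, zero_mul]
    · rw [h'.1 hlt, mul_zero]
  · simp

theorem inv (h : IsUnip M) : IsUnip M⁻¹ := by
  let _ := M.invertibleOfIsUnitDet h.isUnit_det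
  have ht : (M⁻¹).BlockTriangular id := Matrix.blockTriangular_inv_of_blockTriangular h.1
  refine ⟨ht, fun i => ?_⟩
  have h1 : (M⁻¹ * M) i i = 1 := by
    rw [Matrix.nonsing_inv_mul _ h.isUnit_det, Matrix.one_apply_eq]
  rw [Matrix.mul_apply, Finset.sum_eq_single i, h.2, mul_one] at h1
  · exact h1
  · intro k _ hk
    rcases lt_or_gt_of_ne hk with hlt | hlt
    · rw [ht hlt, zero_mul]
    · rw [h.1 hlt, mul_zero]
  · simp

end IsUnip

theorem unipK_iff {N : ℕ} {F : ℂ → Matrix (Fin N) (Fin N) ℂ} :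
    UnipK F ↔ (∀ i j, MeromorphicAt (fun z => F z i j) 0) ∧
      ∀ᶠ z in 𝓝[≠] (0 : ℂ), IsUnip (F z) := by
  refine and_congr_right fun _ => ⟨fun ⟨h₁, h₂⟩ => ?_, fun h => ⟨?_, ?_⟩⟩
  · have h₁' : ∀ᶠ z in 𝓝[≠] (0 : ℂ), ∀ i j : Fin N, j < i → F z i j = 0 := by
      simpa only [eventually_all] using h₁
    filter_upwards [h₁', eventually_all.2 h₂] with z hz hz'
    exact ⟨fun i j hij => hz i j hij, hz'⟩
  · intro i j hij
    filter_upwards [h] with z hz using hz.1 hij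
  · intro i
    filter_upwards [h] with z hz using hz.2 i

theorem MemO.congr {f g : ℂ → ℂ} (hf : MemO f) (h : f =ᶠ[𝓝[≠] (0 : ℂ)] g) : MemO g :=
  let ⟨a, ha, hfa⟩ := hf
  ⟨a, ha, h.symm.trans hfa⟩

theorem AnalyticAt.memO {f : ℂ → ℂ} (hf : AnalyticAt ℂ f 0) : MemO f := ⟨f, hf, .rfl⟩

theorem exists_analytic_rep {N : ℕ} {F : ℂ → Matrix (Fin N) (Fin N) ℂ}
    (hF : ∀ i j, MemO (fun z => F z i j)) :
    ∃ G : ℂ → Matrix (Fin N) (Fin N) ℂ, (∀ i j, AnalyticAt ℂ (fun z => G z i j) 0) ∧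
      ∀ᶠ z in 𝓝[≠] (0 : ℂ), F z = G z := by
  choose G hG hFG using hF
  refine ⟨fun z => Matrix.of fun i j => G i j z, hG, ?_⟩
  have h : ∀ᶠ z in 𝓝[≠] (0 : ℂ), ∀ i j, F z i j = G i j z := by
    simpa only [eventually_all, EventuallyEq] using hFG
  filter_upwards [h] with z hz
  ext i j
  exact hz i j

theorem analyticAt_matrix_mul {N : ℕ} {F G : ℂ → Matrix (Fin N) (Fin N) ℂ}
    (hF : ∀ i j, AnalyticAt ℂ (fun z => F z i j) 0)
    (hG : ∀ i j, AnalyticAt ℂ (fun z => G z i j) 0) (i j : Fin N) :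
    AnalyticAt ℂ (fun z => (F z * G z) i j) 0 := by
  simp only [Matrix.mul_apply]
  exact Finset.analyticAt_fun_sum _ fun k _ => (hF i k).mul (hG k j)

theorem analyticAt_matrix_adjugate {N : ℕ} {F : ℂ → Matrix (Fin N) (Fin N) ℂ}
    (hF : ∀ i j, AnalyticAt ℂ (fun z => F z i j) 0) (i j : Fin N) :
    AnalyticAt ℂ (fun z => (F z).adjugate i j) 0 := by
  simp only [Matrix.adjugate_apply, Matrix.det_apply', Matrix.updateRow_apply]
  refine Finset.analyticAt_fun_sum _ fun σ _ =>
    analyticAt_const.mul (Finset.analyticAt_fun_prod _ fun k _ => ?_)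
  split_ifs
  · exact analyticAt_const
  · exact hF _ _

theorem meromorphicAt_matrix_mul {N : ℕ} {F G : ℂ → Matrix (Fin N) (Fin N) ℂ}
    (hF : ∀ i j, MeromorphicAt (fun z => F z i j) 0)
    (hG : ∀ i j, MeromorphicAt (fun z => G z i j) 0) (i j : Fin N) :
    MeromorphicAt (fun z => (F z * G z) i j) 0 := by
  simp only [Matrix.mul_apply]
  exact MeromorphicAt.fun_sum fun k _ => (hF i k).mul (hG k j)

theorem UnipK.mul {N : ℕ} {F G : ℂ → Matrix (Fin N) (Fin N) ℂ} (hF : UnipK F)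
    (hG : UnipK G) : UnipK fun z => F z * G z := by
  rw [unipK_iff] at *
  refine ⟨meromorphicAt_matrix_mul hF.1 hG.1, ?_⟩
  filter_upwards [hF.2, hG.2] with z h₁ h₂ using h₁.mul h₂

theorem memO_matrix_mul {N : ℕ} {F G : ℂ → Matrix (Fin N) (Fin N) ℂ}
    (hF : ∀ i j, MemO (fun z => F z i j)) (hG : ∀ i j, MemO (fun z => G z i j))
    (i j : Fin N) : MemO (fun z => (F z * G z) i j) := by
  obtain ⟨F', hF', hFF'⟩ := exists_analytic_rep hF
  obtain ⟨G', hG', hGG'⟩ := exists_analytic_rep hG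
  refine ⟨_, analyticAt_matrix_mul hF' hG' i j, ?_⟩
  filter_upwards [hFF', hGG'] with z h₁ h₂
  rw [h₁, h₂]

theorem BirkhoffPos.mul {N : ℕ} {F G : ℂ → Matrix (Fin N) (Fin N) ℂ} (hF : BirkhoffPos F)
    (hG : BirkhoffPos G) : BirkhoffPos fun z => F z * G z :=
  ⟨hF.1.mul hG.1, memO_matrix_mul hF.2 hG.2⟩

theorem BirkhoffPos.exists_inv_mul {N : ℕ} {F G : ℂ → Matrix (Fin N) (Fin N) ℂ}
    (hF : BirkhoffPos F) (hG : BirkhoffPos G) :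
    ∃ H : ℂ → Matrix (Fin N) (Fin N) ℂ, BirkhoffPos H ∧
      ∀ᶠ z in 𝓝[≠] (0 : ℂ), H z = (F z)⁻¹ * G z := by
  obtain ⟨F', hF', hFF'⟩ := exists_analytic_rep hF.2
  obtain ⟨G', hG', hGG'⟩ := exists_analytic_rep hG.2
  have hH := analyticAt_matrix_mul (analyticAt_matrix_adjugate hF') hG'
  have heq : ∀ᶠ z in 𝓝[≠] (0 : ℂ), (F' z).adjugate * G' z = (F z)⁻¹ * G z := by
    filter_upwards [hFF', hGG', (unipK_iff.1 hF.1).2] with z h₁ h₂ h₃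
    rw [h₃.inv_eq_adjugate, h₁, h₂]
  refine ⟨fun z => (F' z).adjugate * G' z,
    ⟨unipK_iff.2 ⟨fun i j => (hH i j).meromorphicAt, ?_⟩, fun i j => (hH i j).memO⟩, heq⟩
  filter_upwards [heq, (unipK_iff.1 hF.1).2, (unipK_iff.1 hG.1).2] with z h₁ h₂ h₃
  rw [h₁]
  exact h₂.inv.mul h₃

/-- A meromorphic germ is the sum of a holomorphic germ and its principal part. -/
theorem MeromorphicAt.exists_principalPart {f : ℂ → ℂ} (hf : MeromorphicAt f 0) :
    ∃ p : Polynomial ℂ, p.coeff 0 = 0 ∧ MemO (fun z => f z + p.eval z⁻¹) := by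
  obtain ⟨n, hn⟩ := hf
  have key : ∀ (n : ℕ) (f g : ℂ → ℂ), AnalyticAt ℂ g 0 →
      (∀ᶠ z in 𝓝[≠] (0 : ℂ), z ^ n * f z = g z) →
      ∃ p : Polynomial ℂ, p.coeff 0 = 0 ∧ MemO (fun z => f z + p.eval z⁻¹) := by
    intro n
    induction n with
    | zero =>
      intro f g hg h
      refine ⟨0, by simp, g, hg, ?_⟩
      filter_upwards [h] with z hz
      simpa using hz
    | succ n ih =>
      intro f g hg h
      obtain ⟨P, hP⟩ := hg
      obtain ⟨p, hp, hO⟩ := ih (fun z => f z - g 0 * z⁻¹ ^ (n + 1)) (dslope g 0)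
        ⟨_, hP.has_fpower_series_dslope_fslope⟩ (by
          filter_upwards [h, self_mem_nhdsWithin] with z hz hz0
          have hz0 : z ≠ 0 := hz0
          rw [dslope_of_ne _ hz0, slope_def_field, ← hz]
          rw [inv_pow]
          field_simp
          ring)
      refine ⟨p - Polynomial.C (g 0) * Polynomial.X ^ (n + 1), by simp [hp], ?_⟩
      refine hO.congr (.of_forall fun z => ?_)
      simp
      ring
  exact key n f _ hn (.of_forall fun z => by simp)

open Classical in
/-- A polynomial in `z⁻¹` without constant term cancelling the principal part of `f`. -/
def negPrincipalPart (f : ℂ → ℂ) : Polynomial ℂ :=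
  if h : ∃ p : Polynomial ℂ, p.coeff 0 = 0 ∧ MemO (fun z => f z + p.eval z⁻¹) then h.choose else 0

theorem coeff_zero_negPrincipalPart (f : ℂ → ℂ) : (negPrincipalPart f).coeff 0 = 0 := by
  unfold negPrincipalPart
  split_ifs with h
  · exact h.choose_spec.1
  · simp

theorem MeromorphicAt.memO_add_negPrincipalPart {f : ℂ → ℂ} (hf : MeromorphicAt f 0) :
    MemO (fun z => f z + (negPrincipalPart f).eval z⁻¹) := by
  unfold negPrincipalPart
  rw [dif_pos hf.exists_principalPart]
  exact hf.exists_principalPart.choose_spec.2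

/-- The entries of the negative Birkhoff factor of `F`, as polynomials in `z⁻¹`, computed
recursively along each row. -/
def birkhoffNegEntry {N : ℕ} (F : ℂ → Matrix (Fin N) (Fin N) ℂ) (i j : Fin N) : Polynomial ℂ :=
  if j < i then 0 else if j = i then 1 else
    negPrincipalPart fun z =>
      ∑ k : {k : Fin N // k < j}, (birkhoffNegEntry F i k).eval z⁻¹ * F z k j
termination_by j
decreasing_by exact k.2

theorem meromorphicAt_eval_inv (p : Polynomial ℂ) :
    MeromorphicAt (fun z : ℂ => p.eval z⁻¹) 0 := by
  simp only [Polynomial.eval_eq_sum_range]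
  exact MeromorphicAt.fun_sum fun k _ =>
    (MeromorphicAt.const _ _).mul ((MeromorphicAt.id 0).inv.pow k)

theorem UnipK.exists_birkhoff {N : ℕ} {F : ℂ → Matrix (Fin N) (Fin N) ℂ} (hF : UnipK F) :
    ∃ fm fp : ℂ → Matrix (Fin N) (Fin N) ℂ, BirkhoffNeg fm ∧ BirkhoffPos fp ∧
      ∀ᶠ z in 𝓝[≠] (0 : ℂ), F z = (fm z)⁻¹ * fp z := by
  have hFu := (unipK_iff.1 hF).2
  set G : ℂ → Matrix (Fin N) (Fin N) ℂ := fun z =>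
    Matrix.of fun i j => (birkhoffNegEntry F i j).eval z⁻¹ with hGdef
  have hGu : ∀ z, IsUnip (G z) := fun z => by
    refine ⟨fun i j hij => ?_, fun i => ?_⟩
    · have hij : j < i := hij
      simp only [hGdef, Matrix.of_apply]
      rw [birkhoffNegEntry, if_pos hij, Polynomial.eval_zero]
    · simp only [hGdef, Matrix.of_apply]
      rw [birkhoffNegEntry, if_neg (lt_irrefl i), if_pos rfl, Polynomial.eval_one]
  have hG : UnipK G :=
    unipK_iff.2 ⟨fun i j => meromorphicAt_eval_inv _, .of_forall hGu⟩
  have hGF := hG.mul hF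
  refine ⟨G, fun z => G z * F z, ⟨hG, fun i j hij => ⟨_, ?_, .of_forall fun z => rfl⟩⟩,
    ⟨hGF, fun i j => ?_⟩, ?_⟩
  · rw [birkhoffNegEntry]
    split_ifs with h₁ h₂
    · simp
    · exact absurd h₂.symm hij
    · exact coeff_zero_negPrincipalPart _
  · rcases lt_trichotomy j i with h | rfl | h
    · exact analyticAt_const.memO.congr (EventuallyEq.symm (hGF.2.1 i j h))
    · exact analyticAt_const.memO.congr (EventuallyEq.symm (hGF.2.2 j))
    · have hmer : MeromorphicAt (fun z =>
          ∑ k : {k : Fin N // k < j}, (birkhoffNegEntry F i k).eval z⁻¹ * F z k j) 0 :=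
        MeromorphicAt.fun_sum fun k _ => (meromorphicAt_eval_inv _).mul (hF.1 _ _)
      refine hmer.memO_add_negPrincipalPart.congr ?_
      filter_upwards [hFu] with z hz
      have hent : birkhoffNegEntry F i j = negPrincipalPart fun z =>
          ∑ k : {k : Fin N // k < j}, (birkhoffNegEntry F i k).eval z⁻¹ * F z k j := by
        conv_lhs => rw [birkhoffNegEntry, if_neg h.not_gt, if_neg h.ne']
      rw [← hent, Matrix.mul_apply, ← Finset.sum_filter_add_sum_filter_not _ (· < j)]
      congr 1
      · rw [Finset.sum_subtype (p := (· < j)) _ (by simp)]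
        rfl
      · rw [Finset.sum_eq_single_of_mem j (by simp), hz.2, mul_one]
        · rfl
        · intro k hk hkj
          have : j < k := lt_of_le_of_ne (by simpa using hk) hkj.symm
          rw [hz.1 this, mul_zero]
  · filter_upwards with z
    rw [Matrix.nonsing_inv_mul_cancel_left _ _ (hGu z).isUnit_det]

theorem eventually_hasDerivAt_matDeriv {N : ℕ} {h : ℂ → Matrix (Fin N) (Fin N) ℂ}
    (hh : ∀ i j, MeromorphicAt (fun z => h z i j) 0) :
    ∀ᶠ z in 𝓝[≠] (0 : ℂ), ∀ i j, HasDerivAt (fun w => h w i j) (matDeriv h z i j) z := by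
  simp only [eventually_all]
  intro i j
  filter_upwards [(hh i j).eventually_analyticAt] with z hz
  exact hz.differentiableAt.hasDerivAt

theorem hasDerivAt_matrix_mul {N : ℕ} {f h : ℂ → Matrix (Fin N) (Fin N) ℂ}
    {f' h' : Matrix (Fin N) (Fin N) ℂ} {z : ℂ}
    (hf : ∀ i j, HasDerivAt (fun w => f w i j) (f' i j) z)
    (hh : ∀ i j, HasDerivAt (fun w => h w i j) (h' i j) z) (i j : Fin N) :
    HasDerivAt (fun w => (f w * h w) i j) ((f' * h z + f z * h') i j) z := by
  simp only [Matrix.mul_apply, Matrix.add_apply, ← Finset.sum_add_distrib]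
  exact HasDerivAt.fun_sum fun k _ => (hf i k).mul (hh k j)

theorem IsSol.mul_gauge {N : ℕ} {f h A B : ℂ → Matrix (Fin N) (Fin N) ℂ}
    (hf : IsSol f A) (hh : UnipK h)
    (hB : ∀ᶠ z in 𝓝[≠] (0 : ℂ),
      B z = (h z)⁻¹ * matDeriv h z + (h z)⁻¹ * A z * h z) :
    IsSol (fun z => f z * h z) B := by
  have hu := (unipK_iff.1 hh).2
  filter_upwards [hf, eventually_hasDerivAt_matDeriv hh.1, hB, hu] with z h₁ h₂ h₃ h₄ i j
  convert hasDerivAt_matrix_mul h₁ h₂ i j using 2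
  rw [h₃, mul_add, Matrix.mul_assoc (f z), Matrix.mul_assoc (f z), Matrix.mul_assoc (h z)⁻¹,
    Matrix.mul_nonsing_inv_cancel_left _ _ h₄.isUnit_det,
    Matrix.mul_nonsing_inv_cancel_left _ _ h₄.isUnit_det, add_comm, Matrix.mul_assoc]

theorem gauge_of_isSol {N : ℕ} {f g h A B : ℂ → Matrix (Fin N) (Fin N) ℂ}
    (hfu : UnipK f) (hf : IsSol f A) (hg : IsSol g B) (hh : UnipK h)
    (hgf : ∀ᶠ z in 𝓝[≠] (0 : ℂ), g z = f z * h z) :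
    ∀ᶠ z in 𝓝[≠] (0 : ℂ), B z = (h z)⁻¹ * matDeriv h z + (h z)⁻¹ * A z * h z := by
  filter_upwards [hf, hg, eventually_hasDerivAt_matDeriv hh.1, hgf,
    eventually_eventually_nhdsWithin.2 hgf, self_mem_nhdsWithin,
    (unipK_iff.1 hfu).2, (unipK_iff.1 hh).2] with z h₁ h₂ h₃ h₄ h₅ hz hfz hhz
  have hz : z ∈ ({0}ᶜ : Set ℂ) := hz
  rw [isOpen_compl_singleton.nhdsWithin_eq hz] at h₅
  have heq : f z * (h z * B z) = f z * (A z * h z + matDeriv h z) := by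
    ext i j
    have hd := (hasDerivAt_matrix_mul h₁ h₃ i j).congr_of_eventuallyEq
      (f₁ := fun w => g w i j) (h₅.mono fun w hw => by simp only [hw])
    have := (h₂ i j).unique hd
    rwa [h₄, Matrix.mul_assoc, Matrix.mul_assoc (f z), ← mul_add] at this
  have heq' : h z * B z = A z * h z + matDeriv h z := by
    simpa only [Matrix.nonsing_inv_mul_cancel_left _ _ hfz.isUnit_det] using
      congrArg ((f z)⁻¹ * ·) heq
  rw [Matrix.mul_assoc, ← mul_add, add_comm, ← heq',
    Matrix.nonsing_inv_mul_cancel_left _ _ hhz.isUnit_det]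

/-- Two flat connections `A₁ dz`, `A₂ dz` with trivial monodromy are equivalent
(i.e. differ by a regular unipotent gauge transformation `h` with entries in `O`)
iff some solutions of the corresponding differential systems have the same
negative parts in their Birkhoff decompositions. -/
theorem stmt6 {N : ℕ} (hN : 1 ≤ N) (A₁ A₂ : ℂ → Matrix (Fin N) (Fin N) ℂ)
    (hA₁ : StrictUpperK A₁) (hA₂ : StrictUpperK A₂)
    (hsol₁ : ∃ f, UnipK f ∧ IsSol f A₁) (hsol₂ : ∃ f, UnipK f ∧ IsSol f A₂) :
    (∃ h : ℂ → Matrix (Fin N) (Fin N) ℂ,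
        UnipK h ∧ (∀ i j, MemO (fun z => h z i j)) ∧
        ∀ᶠ z in 𝓝[≠] (0 : ℂ),
          A₂ z = (h z)⁻¹ * matDeriv h z + (h z)⁻¹ * A₁ z * h z) ↔
    (∃ f₁ f₂ fm fp₁ fp₂ : ℂ → Matrix (Fin N) (Fin N) ℂ,
        UnipK f₁ ∧ IsSol f₁ A₁ ∧ UnipK f₂ ∧ IsSol f₂ A₂ ∧
        BirkhoffNeg fm ∧ BirkhoffPos fp₁ ∧ BirkhoffPos fp₂ ∧
        (∀ᶠ z in 𝓝[≠] (0 : ℂ), f₁ z = (fm z)⁻¹ * fp₁ z) ∧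
        (∀ᶠ z in 𝓝[≠] (0 : ℂ), f₂ z = (fm z)⁻¹ * fp₂ z)) := by
  constructor
  · rintro ⟨h, hu, hO, hA⟩
    obtain ⟨f, hf, hsol⟩ := hsol₁
    obtain ⟨fm, fp, hm, hp, hfac⟩ := hf.exists_birkhoff
    refine ⟨f, fun z => f z * h z, fm, fp, fun z => fp z * h z, hf, hsol, hf.mul hu,
      hsol.mul_gauge hu hA, hm, hp, hp.mul ⟨hu, hO⟩, hfac, ?_⟩
    filter_upwards [hfac] with z hz
    rw [hz, Matrix.mul_assoc]
  · rintro ⟨f₁, f₂, fm, fp₁, fp₂, hf₁, hs₁, hf₂, hs₂, hm, hp₁, hp₂, h₁, h₂⟩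
    obtain ⟨h, hh, heq⟩ := hp₁.exists_inv_mul hp₂
    refine ⟨h, hh.1, hh.2, gauge_of_isSol hf₁ hs₁ hs₂ hh.1 ?_⟩
    filter_upwards [h₁, h₂, heq, (unipK_iff.1 hp₁.1).2] with z e₁ e₂ e₃ hu
    rw [e₁, e₂, e₃, Matrix.mul_assoc, Matrix.mul_nonsing_inv_cancel_left _ _ hu.isUnit_det]
end
end
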